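/- Let γ ∈ (0,1), A < 0, p < 0, and u₀ > 0, and let u : [0,T_b) → (0,∞) be the maximal continuous positive solution of u(t) = u₀ + (A/Γ(γ)) ∫₀ᵗ (t−s)^(γ−1) u(s)^p ds. Then the solution touches 0 in finite time: T_b < ∞ and lim_{t→T_b⁻} u(t) = 0. -/

import Mathlib

open MeasureTheory Set Filter
open scoped ENNReal

/-- The integral `∫₀ᵗ (t - s)^(γ-1) q(s) ds`, which is `Γ(γ)` times the Riemann–Liouville
fractional integral of `q`. -/
noncomputable def fracIntegral (γ : ℝ) (q : ℝ → ℝ) (t : ℝ) : ℝ :=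
  ∫ s in (0:ℝ)..t, (t - s) ^ (γ - 1) * q s

section Kernel

variable {γ : ℝ}

lemma intervalIntegrable_sub_rpow (hγ : 0 < γ) (a b t : ℝ) :
    IntervalIntegrable (fun s => (t - s) ^ (γ - 1)) volume a b := by
  have h := (intervalIntegral.intervalIntegrable_rpow' (a := t - a) (b := t - b)
    (show -1 < γ - 1 by linarith)).comp_sub_left t
  simpa using h

lemma intervalIntegrable_sub_rpow_mul (hγ : 0 < γ) {q : ℝ → ℝ} {a b : ℝ}
    (hq : ContinuousOn q (uIcc a b)) (t : ℝ) :
    IntervalIntegrable (fun s => (t - s) ^ (γ - 1) * q s) volume a b :=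
  (intervalIntegrable_sub_rpow hγ a b t).mul_continuousOn hq

lemma integral_sub_rpow (hγ : 0 < γ) (a t : ℝ) :
    ∫ s in a..t, (t - s) ^ (γ - 1) = (t - a) ^ γ / γ := by
  rw [intervalIntegral.integral_comp_sub_left (fun x => x ^ (γ - 1)) t,
    integral_rpow (Or.inl (by linarith))]
  simp [Real.zero_rpow hγ.ne']

lemma fracIntegral_mono (hγ : 0 < γ) {q₁ q₂ : ℝ → ℝ} {t : ℝ} (ht : 0 ≤ t)
    (h₁ : ContinuousOn q₁ (Icc 0 t)) (h₂ : ContinuousOn q₂ (Icc 0 t))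
    (h : ∀ s ∈ Ioo 0 t, q₁ s ≤ q₂ s) : fracIntegral γ q₁ t ≤ fracIntegral γ q₂ t := by
  refine intervalIntegral.integral_mono_on_of_le_Ioo ht
    (intervalIntegrable_sub_rpow_mul hγ (by rwa [uIcc_of_le ht]) t)
    (intervalIntegrable_sub_rpow_mul hγ (by rwa [uIcc_of_le ht]) t) fun s hs => ?_
  exact mul_le_mul_of_nonneg_left (h s hs) (Real.rpow_nonneg (by linarith [hs.2]) _)

lemma fracIntegral_const (hγ : 0 < γ) (m t : ℝ) :
    fracIntegral γ (fun _ => m) t = t ^ γ / γ * m := by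
  simp [fracIntegral, integral_sub_rpow hγ]

lemma fracIntegral_congr {q₁ q₂ : ℝ → ℝ} {t : ℝ} (ht : 0 ≤ t)
    (h : ∀ s ∈ Ioo 0 t, q₁ s = q₂ s) : fracIntegral γ q₁ t = fracIntegral γ q₂ t := by
  refine intervalIntegral.integral_congr_Ioo_of_le ht fun s hs => ?_
  simp only [h s hs]

lemma fracIntegral_eq_rpow_mul (hγ : 0 < γ) (q : ℝ → ℝ) {t : ℝ} (ht : 0 ≤ t) :
    fracIntegral γ q t = t ^ γ * ∫ x in (0:ℝ)..1, (1 - x) ^ (γ - 1) * q (t * x) := by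
  rcases ht.eq_or_lt with rfl | ht
  · simp [fracIntegral, Real.zero_rpow hγ.ne']
  have h := intervalIntegral.integral_comp_mul_left (a := 0) (b := 1)
    (fun s => (t - s) ^ (γ - 1) * q s) ht.ne'
  simp only [mul_zero, mul_one, smul_eq_mul] at h
  have h₂ : ∫ x in (0:ℝ)..1, (t - t * x) ^ (γ - 1) * q (t * x)
      = t ^ (γ - 1) * ∫ x in (0:ℝ)..1, (1 - x) ^ (γ - 1) * q (t * x) := by
    rw [← intervalIntegral.integral_const_mul]
    refine intervalIntegral.integral_congr fun x hx => ?_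
    rw [uIcc_of_le zero_le_one] at hx
    rw [← mul_assoc, ← Real.mul_rpow ht.le (by linarith [hx.2]), mul_sub, mul_one]
  rw [h₂] at h
  have h₃ : t ^ γ = t * t ^ (γ - 1) := by
    rw [Real.rpow_sub_one ht.ne']; field_simp
  rw [h₃, mul_assoc, h, fracIntegral]
  field_simp

lemma continuousOn_fracIntegral (hγ : 0 < γ) {q : ℝ → ℝ} (hq : Continuous q) :
    ContinuousOn (fracIntegral γ q) (Ici 0) := by
  have hc : Continuous fun t : ℝ => ∫ x in (0:ℝ)..1, (1 - x) ^ (γ - 1) * q (t * x) := by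
    refine continuous_iff_continuousAt.2 fun t₀ => ?_
    obtain ⟨M, hM⟩ := (isCompact_Icc (a := -(|t₀| + 1)) (b := |t₀| + 1)).exists_bound_of_continuousOn
      hq.continuousOn
    refine intervalIntegral.continuousAt_of_dominated_interval
      (bound := fun x => ‖(1 - x) ^ (γ - 1)‖ * M) ?_ ?_
      ((intervalIntegrable_sub_rpow hγ 0 1 1).norm.mul_const M) ?_
    · exact Eventually.of_forall fun t =>
        (intervalIntegrable_sub_rpow_mul hγ (q := fun x => q (t * x))
          (by fun_prop) 1).def'.aestronglyMeasurable
    · filter_upwards [Metric.ball_mem_nhds t₀ one_pos] with t ht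
      refine ae_of_all _ fun x hx => ?_
      rw [uIoc_of_le zero_le_one] at hx
      rw [norm_mul]
      refine mul_le_mul_of_nonneg_left (hM _ (abs_le.1 ?_)) (norm_nonneg _)
      rw [abs_mul, abs_of_pos hx.1]
      have h₁ : |t| ≤ |t₀| + 1 := by
        rw [Metric.mem_ball, Real.dist_eq] at ht
        linarith [abs_sub_abs_le_abs_sub t t₀]
      nlinarith [abs_nonneg t, hx.1, hx.2]
    · exact ae_of_all _ fun x _ => by fun_prop
  have hr : Continuous fun t : ℝ => t ^ γ :=
    Real.continuous_rpow_const hγ.le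
  exact (hr.mul hc).continuousOn.congr fun t ht => fracIntegral_eq_rpow_mul hγ q ht

lemma abs_fracIntegral_sub_le (hγ : 0 < γ) {q₁ q₂ : ℝ → ℝ} (h₁ : Continuous q₁)
    (h₂ : Continuous q₂) {T t D : ℝ} (hT : 0 ≤ T) (hTt : T ≤ t)
    (heq : ∀ s ∈ Icc 0 T, q₁ s = q₂ s) (hD : ∀ s ∈ Icc T t, |q₁ s - q₂ s| ≤ D) :
    |fracIntegral γ q₁ t - fracIntegral γ q₂ t| ≤ (t - T) ^ γ / γ * D := by
  have hi : ∀ {q : ℝ → ℝ}, Continuous q → ∀ a b,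
      IntervalIntegrable (fun s => (t - s) ^ (γ - 1) * q s) volume a b := fun hq a b =>
    intervalIntegrable_sub_rpow_mul hγ hq.continuousOn t
  have hsub : fracIntegral γ q₁ t - fracIntegral γ q₂ t
      = ∫ s in T..t, ((t - s) ^ (γ - 1) * q₁ s - (t - s) ^ (γ - 1) * q₂ s) := by
    have hzero : ∫ s in (0:ℝ)..T, (t - s) ^ (γ - 1) * q₁ s
        = ∫ s in (0:ℝ)..T, (t - s) ^ (γ - 1) * q₂ s := by
      refine intervalIntegral.integral_congr fun s hs => ?_
      rw [uIcc_of_le hT] at hs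
      simp only [heq s hs]
    rw [intervalIntegral.integral_sub (hi h₁ _ _) (hi h₂ _ _), fracIntegral, fracIntegral,
      ← intervalIntegral.integral_add_adjacent_intervals (hi h₁ 0 T) (hi h₁ T t),
      ← intervalIntegral.integral_add_adjacent_intervals (hi h₂ 0 T) (hi h₂ T t), hzero]
    ring
  rw [hsub, ← integral_sub_rpow hγ, ← intervalIntegral.integral_mul_const, ← Real.norm_eq_abs]
  refine intervalIntegral.norm_integral_le_of_norm_le hTt (ae_of_all _ fun s hs => ?_)
    ((intervalIntegrable_sub_rpow hγ T t t).mul_const D)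
  have hk : 0 ≤ (t - s) ^ (γ - 1) := Real.rpow_nonneg (by linarith [hs.2]) _
  rw [← mul_sub, norm_mul, Real.norm_of_nonneg hk, Real.norm_eq_abs]
  exact mul_le_mul_of_nonneg_left (hD s ⟨hs.1.le, hs.2⟩) hk

end Kernel

/-- A solution on `[0, T]` of a fractional integral equation with Lipschitz nonlinearity extends
beyond `T`. -/
lemma exists_extension_of_lipschitz {γ a u₀ T : ℝ} (hγ : 0 < γ) (hT : 0 ≤ T) {g w : ℝ → ℝ}
    {K : NNReal} (hg : LipschitzWith K g) (hw : Continuous w)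
    (hsol : ∀ t ∈ Icc 0 T, w t = u₀ + a * fracIntegral γ (fun s => g (w s)) t) :
    ∃ δ > 0, ∃ v : ℝ → ℝ, Continuous v ∧ (∀ t ≤ T, v t = w t) ∧
      ∀ t ∈ Icc 0 (T + δ), v t = u₀ + a * fracIntegral γ (fun s => g (v s)) t := by
  have hden : 0 < 4 * |a| * K + 1 := by positivity
  obtain ⟨δ, hδ, hδγ⟩ : ∃ δ : ℝ, 0 < δ ∧ δ ^ γ = γ / (4 * |a| * K + 1) :=
    ⟨(γ / (4 * |a| * K + 1)) ^ γ⁻¹, by positivity,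
      Real.rpow_inv_rpow (by positivity) hγ.ne'⟩
  have hTδ : T ≤ T + δ := by linarith
  let l : Icc T (T + δ) := ⟨T, left_mem_Icc.2 hTδ⟩
  -- glue `w` on `(-∞, T]` with a continuous function on `[T, T + δ]`
  let e : C(Icc T (T + δ), ℝ) → ℝ → ℝ := fun φ s => w (min s T) + IccExtend hTδ φ s - φ l
  have he : ∀ φ, Continuous (e φ) := fun φ => by
    have := φ.continuous.Icc_extend' (h := hTδ)
    fun_prop
  have hge : ∀ φ, Continuous fun s => g (e φ s) := fun φ => hg.continuous.comp (he φ)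
  have he_left : ∀ φ, ∀ s ≤ T, e φ s = w s := fun φ s hs => by
    simp [e, IccExtend_of_le_left hTδ φ hs, min_eq_left hs, l]
  let Φ : C(Icc T (T + δ), ℝ) → C(Icc T (T + δ), ℝ) := fun φ =>
    ⟨fun t => u₀ + a * fracIntegral γ (fun s => g (e φ s)) t, by
      have := (continuousOn_fracIntegral hγ (hge φ)).comp_continuous
        (continuous_subtype_val (p := fun t => t ∈ Icc T (T + δ)))
        fun t => hT.trans t.2.1
      fun_prop⟩
  have hΦ : ContractingWith (1 / 2) Φ := by
    refine ⟨by norm_num, LipschitzWith.of_dist_le_mul fun φ ψ => ?_⟩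
    refine (ContinuousMap.dist_le (by positivity)).2 fun t => ?_
    have hD : ∀ s ∈ Icc T (t : ℝ), |g (e φ s) - g (e ψ s)| ≤ K * (2 * dist φ ψ) := by
      intro s _
      refine (hg.dist_le_mul _ _).trans (mul_le_mul_of_nonneg_left ?_ K.2)
      have h₁ : |IccExtend hTδ φ s - IccExtend hTδ ψ s| ≤ dist φ ψ :=
        ContinuousMap.dist_apply_le_dist (f := φ) (g := ψ) (projIcc T (T + δ) hTδ s)
      have h₂ : |φ l - ψ l| ≤ dist φ ψ :=
        ContinuousMap.dist_apply_le_dist (f := φ) (g := ψ) l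
      rw [Real.dist_eq]
      calc |e φ s - e ψ s|
          = |(IccExtend hTδ φ s - IccExtend hTδ ψ s) - (φ l - ψ l)| := by
            congr 1; simp only [e]; ring
        _ ≤ _ := (abs_sub _ _).trans (by linarith)
    have hle := abs_fracIntegral_sub_le hγ (hge φ) (hge ψ) hT t.2.1
      (fun s hs => by rw [he_left φ s hs.2, he_left ψ s hs.2]) hD
    have hpow : ((t : ℝ) - T) ^ γ / γ ≤ 1 / (4 * |a| * K + 1) := by
      have : ((t : ℝ) - T) ^ γ ≤ δ ^ γ :=
        Real.rpow_le_rpow (by linarith [t.2.1]) (by linarith [t.2.2]) hγ.le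
      rw [div_le_iff₀ hγ]
      calc _ ≤ _ := this
        _ = _ := by rw [hδγ]; ring
    have hd : (0:ℝ) ≤ dist φ ψ := dist_nonneg
    have hcoef : |a| * (1 / (4 * |a| * K + 1) * (K * 2)) ≤ 1 / 2 := by
      rw [show |a| * (1 / (4 * |a| * K + 1) * (K * 2)) = 2 * |a| * K / (4 * |a| * K + 1) by ring,
        div_le_div_iff₀ hden two_pos]
      linarith
    calc dist (Φ φ t) (Φ ψ t)
        = |a| * |fracIntegral γ (fun s => g (e φ s)) t - fracIntegral γ (fun s => g (e ψ s)) t| := by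
          rw [Real.dist_eq, ← abs_mul]; congr 1; simp only [Φ, ContinuousMap.coe_mk]; ring
      _ ≤ |a| * (1 / (4 * |a| * K + 1) * (K * (2 * dist φ ψ))) := by
          refine mul_le_mul_of_nonneg_left (hle.trans ?_) (abs_nonneg a)
          exact mul_le_mul_of_nonneg_right hpow (by positivity)
      _ = |a| * (1 / (4 * |a| * K + 1) * (K * 2)) * dist φ ψ := by ring
      _ ≤ 1 / 2 * dist φ ψ := mul_le_mul_of_nonneg_right hcoef hd
      _ = _ := by norm_num
  have : Nonempty C(Icc T (T + δ), ℝ) := ⟨0⟩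
  obtain ⟨φ, hφ⟩ : ∃ φ, Φ φ = φ := ⟨_, hΦ.fixedPoint_isFixedPt⟩
  have hφt : ∀ t : Icc T (T + δ), φ t = u₀ + a * fracIntegral γ (fun s => g (e φ s)) t :=
    fun t => (DFunLike.congr_fun hφ t).symm
  have hleft : ∀ t ∈ Icc 0 T, w t = u₀ + a * fracIntegral γ (fun s => g (e φ s)) t := by
    intro t ht
    rw [hsol t ht, fracIntegral_congr ht.1 fun s hs => ?_]
    rw [he_left φ s (hs.2.le.trans ht.2)]
  have hl : φ l = w T := (hφt l).trans (hleft T ⟨hT, le_rfl⟩).symm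
  refine ⟨δ, hδ, e φ, he φ, he_left φ, fun t ht => ?_⟩
  rcases le_total t T with h | h
  · rw [he_left φ t h, hleft t ⟨ht.1, h⟩]
  · have : e φ t = φ ⟨t, h, ht.2⟩ := by
      simp [e, min_eq_right h, hl, IccExtend_of_mem hTδ φ ⟨h, ht.2⟩]
    rw [this, hφt]

lemma exists_lipschitzWith_max_rpow {m : ℝ} (hm : 0 < m) {p : ℝ} (hp : p ≤ 1) :
    ∃ K, LipschitzWith K fun x : ℝ => max x m ^ p := by
  have h : LipschitzOnWith (‖p‖₊ * ‖m ^ (p - 1)‖₊) (fun x : ℝ => x ^ p) (Ici m) := by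
    refine (convex_Ici m).lipschitzOnWith_of_nnnorm_hasDerivWithin_le
      (f' := fun x => p * x ^ (p - 1)) (fun x hx => ?_) fun x hx => ?_
    · exact (Real.hasDerivAt_rpow_const (Or.inl (hm.trans_le hx).ne')).hasDerivWithinAt
    · rw [nnnorm_mul]
      refine mul_le_mul_of_nonneg_left ?_ zero_le
      rw [← NNReal.coe_le_coe, coe_nnnorm, coe_nnnorm, Real.norm_of_nonneg
        (Real.rpow_nonneg (hm.le.trans hx) _), Real.norm_of_nonneg (Real.rpow_nonneg hm.le _)]
      exact Real.rpow_le_rpow_of_nonpos hm hx (by linarith)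
  have h₂ : LipschitzOnWith 1 (fun x : ℝ => max x m) univ :=
    (LipschitzWith.id.max_const m).lipschitzOnWith
  exact ⟨_, lipschitzOnWith_univ.1 (h.comp h₂ fun x _ => le_max_right x m)⟩

lemma strictAntiOn_of_eq_sub_fracIntegral {γ c p u₀ R : ℝ} {u : ℝ → ℝ} (hγ : 0 < γ) (hc : 0 < c)
    (hp : p < 0) (hpos : ∀ t ∈ Icc 0 R, 0 < u t) (hcont : ContinuousOn u (Icc 0 R))
    (hsol : ∀ t ∈ Icc 0 R, u t = u₀ - c * fracIntegral γ (fun s => u s ^ p) t) :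
    StrictAntiOn u (Icc 0 R) := by
  intro x hx y hy hxy
  have hup : ContinuousOn (fun s => u s ^ p) (Icc 0 R) :=
    hcont.rpow_const fun s hs => Or.inl (hpos s hs).ne'
  obtain ⟨τ, hτ, rfl⟩ : ∃ τ, 0 < τ ∧ y = x + τ := ⟨y - x, by linarith, by ring⟩
  have hshift : MapsTo (fun t => t + τ) (Icc 0 x) (Icc 0 R) := fun t ht =>
    ⟨by linarith [ht.1], by linarith [ht.2, hy.2]⟩
  have hsub : Icc 0 x ⊆ Icc 0 R := Icc_subset_Icc_right hx.2
  have hcx : ContinuousOn u (Icc 0 x) := hcont.mono hsub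
  have hcs : ContinuousOn (fun t => u (t + τ)) (Icc 0 x) := hcont.comp (by fun_prop) hshift
  by_contra! hle
  obtain ⟨t, ⟨htx, htle⟩, hmin⟩ : ∃ t, IsLeast {t ∈ Icc 0 x | u t ≤ u (t + τ)} t :=
    (isCompact_Icc.of_isClosed_subset (isClosed_Icc.isClosed_le hcx hcs)
      (sep_subset _ _)).exists_isLeast ⟨x, ⟨hx.1, le_rfl⟩, hle⟩
  have hlt : ∀ s ∈ Ioo 0 t, u (s + τ) ≤ u s := fun s hs => by
    by_contra! h
    exact (hmin ⟨⟨hs.1.le, hs.2.le.trans htx.2⟩, h.le⟩).not_gt hs.2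
  have htsub : Icc 0 t ⊆ Icc 0 x := Icc_subset_Icc_right htx.2
  have htτ := hshift htx
  have hsplit : fracIntegral γ (fun s => u s ^ p) (t + τ)
      = (∫ s in (0:ℝ)..τ, (t + τ - s) ^ (γ - 1) * u s ^ p)
        + fracIntegral γ (fun s => u (s + τ) ^ p) t := by
    have hi : ∀ a ∈ Icc 0 R, ∀ b ∈ Icc 0 R,
        IntervalIntegrable (fun s => (t + τ - s) ^ (γ - 1) * u s ^ p) volume a b :=
      fun a ha b hb => intervalIntegrable_sub_rpow_mul hγ
        (hup.mono (ordConnected_Icc.uIcc_subset ha hb)) _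
    have h0 : (0:ℝ) ∈ Icc 0 R := ⟨le_rfl, hx.1.trans hx.2⟩
    have hτR : τ ∈ Icc 0 R := ⟨hτ.le, by linarith [htx.1, htτ.2]⟩
    rw [fracIntegral, ← intervalIntegral.integral_add_adjacent_intervals (hi 0 h0 τ hτR)
      (hi τ hτR (t + τ) htτ)]
    congr 1
    have h := intervalIntegral.integral_comp_add_right (a := 0) (b := t)
      (fun s => (t + τ - s) ^ (γ - 1) * u s ^ p) τ
    rw [zero_add] at h
    rw [← h, fracIntegral]
    simp only [add_sub_add_right_eq_sub]
  have hfirst : 0 < ∫ s in (0:ℝ)..τ, (t + τ - s) ^ (γ - 1) * u s ^ p := by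
    have hs : Icc 0 τ ⊆ Icc 0 R := Icc_subset_Icc_right (by linarith [htx.1, htτ.2])
    refine intervalIntegral.intervalIntegral_pos_of_pos_on
      (intervalIntegrable_sub_rpow_mul hγ (hup.mono (by rwa [uIcc_of_le hτ.le])) _)
      (fun s hsτ => ?_) hτ
    exact mul_pos (Real.rpow_pos_of_pos (by linarith [hsτ.2, htx.1]) _)
      (Real.rpow_pos_of_pos (hpos s (hs ⟨hsτ.1.le, hsτ.2.le⟩)) _)
  have hsecond : fracIntegral γ (fun s => u s ^ p) t ≤ fracIntegral γ (fun s => u (s + τ) ^ p) t :=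
    fracIntegral_mono hγ htx.1 (hup.mono (htsub.trans hsub))
      (hup.comp (by fun_prop) (hshift.mono_left htsub)) fun s hs =>
        Real.rpow_le_rpow_of_nonpos (hpos _ (hshift (htsub ⟨hs.1.le, hs.2.le⟩))) (hlt s hs) hp.le
  rw [hsol t (hsub htx), hsol _ htτ, hsplit] at htle
  nlinarith [mul_pos hc hfirst, mul_le_mul_of_nonneg_left hsecond hc.le]

lemma le_sub_of_eq_sub_fracIntegral {γ c p u₀ R : ℝ} {u : ℝ → ℝ} (hγ : 0 < γ) (hc : 0 < c)
    (hp : p < 0) (hR : 0 ≤ R) (hu0 : u 0 = u₀) (hpos : ∀ t ∈ Icc 0 R, 0 < u t)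
    (hcont : ContinuousOn u (Icc 0 R))
    (hsol : ∀ t ∈ Icc 0 R, u t = u₀ - c * fracIntegral γ (fun s => u s ^ p) t) :
    u R ≤ u₀ - c * (R ^ γ / γ * u₀ ^ p) := by
  have hanti := strictAntiOn_of_eq_sub_fracIntegral hγ hc hp hpos hcont hsol
  rw [hsol R ⟨hR, le_rfl⟩, ← fracIntegral_const hγ]
  refine sub_le_sub_left (mul_le_mul_of_nonneg_left ?_ hc.le) _
  refine fracIntegral_mono hγ hR continuousOn_const
    (hcont.rpow_const fun s hs => Or.inl (hpos s hs).ne') fun s hs => ?_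
  have hsR : s ∈ Icc 0 R := ⟨hs.1.le, hs.2.le⟩
  refine Real.rpow_le_rpow_of_nonpos (hpos s hsR) ?_ hp.le
  exact hu0 ▸ (hanti ⟨le_rfl, hR⟩ hsR hs.1).le

/-- A solution on `[0, T)` with a positive left limit at `T` extends beyond `T`. -/
lemma exists_pos_extension {γ a p u₀ T L : ℝ} {u : ℝ → ℝ} (hγ : 0 < γ) (hp : p < 0) (hT : 0 < T)
    (hL : 0 < L) (hLu : ∀ t ∈ Ico 0 T, L ≤ u t) (hcont : ContinuousOn u (Ico 0 T))
    (hlim : Tendsto u (nhdsWithin T (Iio T)) (nhds L))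
    (hsol : ∀ t ∈ Ico 0 T, u t = u₀ + a * fracIntegral γ (fun s => u s ^ p) t) :
    ∃ T' > T, ∃ v : ℝ → ℝ, (∀ t ∈ Ico 0 T', 0 < v t) ∧ ContinuousOn v (Ico 0 T') ∧
      (∀ t ∈ Ico 0 T', v t = u₀ + a * fracIntegral γ (fun s => v s ^ p) t) ∧
      ∀ t ∈ Ico 0 T, v t = u t := by
  obtain ⟨K, hK⟩ := exists_lipschitzWith_max_rpow (half_pos hL) (hp.le.trans zero_le_one)
  have hupd : ContinuousOn (Function.update u T L) (Icc 0 T) := by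
    rw [continuousOn_update_iff, Icc_sdiff_right]
    exact ⟨hcont, fun _ => hlim.mono_left (nhdsWithin_mono T Ico_subset_Iio_self)⟩
  obtain ⟨w, hw, hwu, hwT⟩ : ∃ w : ℝ → ℝ, Continuous w ∧ (∀ t ∈ Ico 0 T, w t = u t) ∧ w T = L := by
    refine ⟨IccExtend hT.le ((Icc 0 T).domRestrict (Function.update u T L)),
      hupd.domRestrict.Icc_extend', fun t ht => ?_, ?_⟩
    · rw [IccExtend_of_mem _ _ ⟨ht.1, ht.2.le⟩, domRestrict_apply,
        Function.update_of_ne ht.2.ne]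
    · simp
  have hwsol : EqOn w
      (fun t => u₀ + a * fracIntegral γ (fun s => max (w s) (L / 2) ^ p) t) (Icc 0 T) := by
    refine EqOn.of_subset_closure (s := Ico 0 T) (fun t ht => ?_) hw.continuousOn ?_
      Ico_subset_Icc_self (closure_Ico hT.ne).ge
    · rw [hwu t ht, hsol t ht, fracIntegral_congr ht.1 fun s hs => ?_]
      have hsT : s ∈ Ico 0 T := ⟨hs.1.le, hs.2.trans ht.2⟩
      rw [hwu s hsT, max_eq_left (by linarith [hLu s hsT])]
    · have := (continuousOn_fracIntegral hγ (hK.continuous.comp hw)).mono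
        fun t (ht : t ∈ Icc 0 T) => ht.1
      exact continuousOn_const.add (continuousOn_const.mul this)
  obtain ⟨δ, hδ, v, hv, hvw, hvsol⟩ := exists_extension_of_lipschitz hγ hT.le hK hw hwsol
  obtain ⟨η, hη, hηv⟩ : ∃ η > 0, ∀ t, |t - T| < η → L / 2 < v t := by
    have h : ∀ᶠ t in nhds T, L / 2 < v t :=
      hv.continuousAt.eventually (lt_mem_nhds (by rw [hvw T le_rfl, hwT]; exact half_lt_self hL))
    exact Metric.eventually_nhds_iff.1 h
  have hvu : ∀ t ∈ Ico 0 T, v t = u t := fun t ht => (hvw t ht.2.le).trans (hwu t ht)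
  have hvL : ∀ t ∈ Ico 0 (T + min δ η), L / 2 < v t := by
    intro t ht
    rcases lt_or_ge t T with h | h
    · rw [hvu t ⟨ht.1, h⟩]; linarith [hLu t ⟨ht.1, h⟩]
    · refine hηv t ?_
      rw [abs_of_nonneg (by linarith)]
      linarith [ht.2, min_le_right δ η]
  refine ⟨T + min δ η, lt_add_of_pos_right _ (lt_min hδ hη), v,
    fun t ht => (half_pos hL).trans (hvL t ht), hv.continuousOn, fun t ht => ?_, hvu⟩
  rw [hvsol t ⟨ht.1, by linarith [ht.2, min_le_left δ η]⟩, fracIntegral_congr ht.1 fun s hs => ?_]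
  rw [max_eq_left (hvL s ⟨hs.1.le, hs.2.trans ht.2⟩).le]

/-- For `A < 0`, `p < 0`, the maximal continuous positive solution of
`D_c^γ u = A u^p`, `u(0) = u₀ > 0`, touches `0` in finite time: `T_b < ∞` and
`u(t) → 0` as `t → T_b⁻`. -/
theorem fractional_ode_touches_zero
    (γ A p u₀ : ℝ) (hγ : γ ∈ Set.Ioo (0:ℝ) 1) (hA : A < 0) (hp : p < 0) (hu₀ : 0 < u₀)
    (Tb : ℝ≥0∞) (hTb : 0 < Tb) (u : ℝ → ℝ)
    (hu0 : u 0 = u₀)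
    (hpos : ∀ t : ℝ, 0 ≤ t → ENNReal.ofReal t < Tb → 0 < u t)
    (hcont : ContinuousOn u {t : ℝ | 0 ≤ t ∧ ENNReal.ofReal t < Tb})
    (heq : ∀ t : ℝ, 0 ≤ t → ENNReal.ofReal t < Tb →
      u t = u₀ + (A / Real.Gamma γ) * ∫ s in (0:ℝ)..t, (t - s) ^ (γ - 1) * u s ^ p)
    (hmax : ¬ ∃ (T' : ℝ≥0∞) (v : ℝ → ℝ), Tb < T' ∧
      v 0 = u₀ ∧
      (∀ t : ℝ, 0 ≤ t → ENNReal.ofReal t < T' → 0 < v t) ∧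
      ContinuousOn v {t : ℝ | 0 ≤ t ∧ ENNReal.ofReal t < T'} ∧
      (∀ t : ℝ, 0 ≤ t → ENNReal.ofReal t < T' →
        v t = u₀ + (A / Real.Gamma γ) * ∫ s in (0:ℝ)..t, (t - s) ^ (γ - 1) * v s ^ p) ∧
      (∀ t : ℝ, 0 ≤ t → ENNReal.ofReal t < Tb → v t = u t)) :
    Tb ≠ ⊤ ∧
    Filter.Tendsto u (nhdsWithin Tb.toReal (Set.Iio Tb.toReal)) (nhds 0) := by
  have hγ0 : 0 < γ := hγ.1
  obtain ⟨c, hc, hAc⟩ : ∃ c : ℝ, 0 < c ∧ A / Real.Gamma γ = -c :=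
    ⟨-(A / Real.Gamma γ), neg_pos.2 (div_neg_of_neg_of_pos hA (Real.Gamma_pos_of_pos hγ0)),
      (neg_neg _).symm⟩
  have hdom : ∀ {R : ℝ}, ENNReal.ofReal R < Tb → ∀ t ∈ Icc 0 R, ENNReal.ofReal t < Tb :=
    fun hR t ht => (ENNReal.ofReal_le_ofReal ht.2).trans_lt hR
  have hposR : ∀ {R : ℝ}, ENNReal.ofReal R < Tb → ∀ t ∈ Icc 0 R, 0 < u t :=
    fun hR t ht => hpos t ht.1 (hdom hR t ht)
  have hcontR : ∀ {R : ℝ}, ENNReal.ofReal R < Tb → ContinuousOn u (Icc 0 R) :=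
    fun hR => hcont.mono fun t ht => ⟨ht.1, hdom hR t ht⟩
  have hsolR : ∀ {R : ℝ}, ENNReal.ofReal R < Tb → ∀ t ∈ Icc 0 R,
      u t = u₀ - c * fracIntegral γ (fun s => u s ^ p) t := fun hR t ht => by
    rw [heq t ht.1 (hdom hR t ht), hAc, neg_mul, ← sub_eq_add_neg, fracIntegral]
  have hTb_top : Tb ≠ ⊤ := by
    rintro rfl
    have hq : 0 < u₀ ^ p := Real.rpow_pos_of_pos hu₀ p
    obtain ⟨R, hR, hRγ⟩ : ∃ R : ℝ, 0 ≤ R ∧ R ^ γ = γ * u₀ / (c * u₀ ^ p) :=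
      ⟨(γ * u₀ / (c * u₀ ^ p)) ^ γ⁻¹, by positivity,
        Real.rpow_inv_rpow (by positivity) hγ0.ne'⟩
    have hRT : ENNReal.ofReal R < ⊤ := ENNReal.ofReal_lt_top
    have h := le_sub_of_eq_sub_fracIntegral hγ0 hc hp hR hu0 (hposR hRT) (hcontR hRT) (hsolR hRT)
    have hz : c * (R ^ γ / γ * u₀ ^ p) = u₀ := by
      rw [hRγ]; field_simp
    linarith [hposR hRT R ⟨hR, le_rfl⟩]
  refine ⟨hTb_top, ?_⟩
  obtain ⟨T, hT, rfl⟩ : ∃ T : ℝ, 0 < T ∧ Tb = ENNReal.ofReal T :=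
    ⟨Tb.toReal, ENNReal.toReal_pos hTb.ne' hTb_top, (ENNReal.ofReal_toReal hTb_top).symm⟩
  rw [ENNReal.toReal_ofReal hT.le]
  have hlt : ∀ {t : ℝ}, t < T → ENNReal.ofReal t < ENNReal.ofReal T :=
    fun h => (ENNReal.ofReal_lt_ofReal_iff hT).2 h
  have hanti : StrictAntiOn u (Ico 0 T) := fun x hx y hy hxy =>
    strictAntiOn_of_eq_sub_fracIntegral hγ0 hc hp (hposR (hlt hy.2)) (hcontR (hlt hy.2))
      (hsolR (hlt hy.2)) ⟨hx.1, hxy.le⟩ ⟨hy.1, le_rfl⟩ hxy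
  have hlow : 0 ∈ lowerBounds (u '' Ico 0 T) := by
    rintro _ ⟨t, ht, rfl⟩
    exact (hpos t ht.1 (hlt ht.2)).le
  obtain ⟨L, hL⟩ := Real.exists_isGLB (s := u '' Ico 0 T) ⟨u 0, 0, ⟨le_rfl, hT⟩, rfl⟩ ⟨0, hlow⟩
  have hLu : ∀ t ∈ Ico 0 T, L ≤ u t := fun t ht => hL.1 ⟨t, ht, rfl⟩
  have hlim : Tendsto u (nhdsWithin T (Iio T)) (nhds L) := by
    refine tendsto_order.2 ⟨fun b hb => ?_, fun b hb => ?_⟩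
    · filter_upwards [Ioo_mem_nhdsLT hT] with t ht
      exact hb.trans_le (hLu t ⟨ht.1.le, ht.2⟩)
    · obtain ⟨_, ⟨x, hx, rfl⟩, hxb⟩ := (isGLB_lt_iff hL).1 hb
      filter_upwards [Ioo_mem_nhdsLT hx.2] with t ht
      exact (hanti hx ⟨hx.1.trans ht.1.le, ht.2⟩ ht.1).trans hxb
  rcases (hL.2 hlow).eq_or_lt with rfl | hLpos
  · exact hlim
  exfalso
  obtain ⟨T', hT', v, hvpos, hvcont, hvsol, hvu⟩ := exists_pos_extension hγ0 hp hT hLpos hLu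
    (hcont.mono fun t ht => ⟨ht.1, hlt ht.2⟩) hlim fun t ht => heq t ht.1 (hlt ht.2)
  have hmem : ∀ {S t : ℝ}, 0 ≤ t → ENNReal.ofReal t < ENNReal.ofReal S → t ∈ Ico 0 S :=
    fun h0 h => ⟨h0, (ENNReal.ofReal_lt_ofReal_iff_of_nonneg h0).1 h⟩
  exact hmax ⟨ENNReal.ofReal T', v, (ENNReal.ofReal_lt_ofReal_iff (hT.trans hT')).2 hT',
    (hvu 0 ⟨le_rfl, hT⟩).trans hu0, fun t h0 h => hvpos t (hmem h0 h),
    hvcont.mono fun t ht => hmem ht.1 ht.2, fun t h0 h => hvsol t (hmem h0 h),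
    fun t h0 h => hvu t (hmem h0 h)⟩
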